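/- There is an absolute constant C ≥ 0 with the following property: if A ⊆ F_2^n is nonempty, K ≥ 1 is a real number with |A + A| ≤ K·|A|, 0 ≤ r ≤ n is an integer, and A + A + A ⊆ H_r(n), then r ≥ log₂ |A| − 42·log₂ K − C. -/

import Mathlib

open Finset Pointwise

abbrev F2 (n : ℕ) := Fin n → ZMod 2

/-- The standard basis vector `e i` of `F_2^n`. -/
def stdBasis {n : ℕ} (i : Fin n) : F2 n := Pi.single i 1

/-- `A` is a downset: whenever `x i = 0` and `x + e i ∈ A`, also `x ∈ A`. -/
def IsDownset {n : ℕ} (A : Finset (F2 n)) : Prop :=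
  ∀ x : F2 n, ∀ i : Fin n, x i = 0 → x + stdBasis i ∈ A → x ∈ A

/-- `A` is shift-minimal: whenever `i < j`, `x i = x j = 0` and `x + e j ∈ A`,
also `x + e i ∈ A`. -/
def IsShiftMinimal {n : ℕ} (A : Finset (F2 n)) : Prop :=
  ∀ x : F2 n, ∀ i j : Fin n, i < j → x i = 0 → x j = 0 →
    x + stdBasis j ∈ A → x + stdBasis i ∈ A

/-- The Hamming ball of radius `r` in `F_2^n`. -/
def hamBall (n r : ℕ) : Finset (F2 n) := Finset.univ.filter fun x => hammingNorm x ≤ r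

section

open Real

/-- Gibbs' inequality on two points, in unnormalised form. -/
lemma binEntropy_add_le_log_add {p c d : ℝ} (hp₀ : 0 ≤ p) (hp₁ : p ≤ 1) (hc : 0 ≤ c) (hd : 0 ≤ d)
    (hpc : 0 < p → 0 < c) (hpd : p < 1 → 0 < d) :
    binEntropy p + p * log c + (1 - p) * log d ≤ log (c + d) := by
  rcases hp₀.eq_or_lt with rfl | hp₀
  · have := hpd one_pos
    simpa using log_le_log this (by linarith)
  rcases hp₁.eq_or_lt with rfl | hp₁
  · simpa using log_le_log (hpc one_pos) (by linarith)
  have hc := hpc hp₀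
  have hd := hpd hp₁
  have hq : 0 < 1 - p := by linarith
  have h := strictConcaveOn_log_Ioi.concaveOn.2 (x := c / p) (y := d / (1 - p))
    (div_pos hc hp₀) (div_pos hd hq) hp₀.le hq.le (by ring)
  simp only [smul_eq_mul] at h
  rw [mul_div_cancel₀ _ hp₀.ne', mul_div_cancel₀ _ hq.ne', log_div hc.ne' hp₀.ne',
    log_div hd.ne' hq.ne'] at h
  rw [binEntropy_eq_negMulLog_add_negMulLog_one_sub, negMulLog, negMulLog]
  linarith

/-- The parameter of the sum modulo two of independent Bernoulli variables. -/
def bernoulliConv (x y : ℝ) : ℝ := x * (1 - y) + (1 - x) * y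

lemma binEntropy_chord {t : ℝ} (ht₀ : 0 ≤ t) (ht₁ : t ≤ 1) {x : ℝ} (hx₀ : 0 ≤ x) (hx₁ : x ≤ 1) :
    (1 - t) * binEntropy x + t * log 2 ≤ binEntropy ((1 - t) * x + t * 2⁻¹) := by
  have h := strictConcave_binEntropy.concaveOn.2 (x := x) (y := 2⁻¹) ⟨hx₀, hx₁⟩
    ⟨by norm_num, by norm_num⟩ (sub_nonneg.2 ht₁) ht₀ (by ring)
  simpa using h

lemma two_mul_mul_log_two_le_binEntropy {x : ℝ} (hx₀ : 0 ≤ x) (hx₁ : x ≤ 2⁻¹) :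
    2 * x * log 2 ≤ binEntropy x := by
  have h := binEntropy_chord (t := 2 * x) (by linarith) (by linarith) le_rfl zero_le_one
  simpa [mul_comm, mul_assoc, mul_left_comm] using h

lemma le_binEntropy_bernoulliConv_of_le_half {x y : ℝ} (hx₀ : 0 ≤ x) (hx₁ : x ≤ 1) (hy₀ : 0 ≤ y)
    (hy₁ : y ≤ 2⁻¹) :
    (1 - 2 * y) * binEntropy x + 2 * y * log 2 ≤ binEntropy (bernoulliConv x y) := by
  have h := binEntropy_chord (t := 2 * y) (by linarith) (by linarith) hx₀ hx₁
  convert h using 2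
  rw [bernoulliConv]; ring

lemma negMulLog_add_le {s t : ℝ} (hs : 0 ≤ s) (ht : 0 ≤ t) :
    negMulLog s + negMulLog t ≤ negMulLog (s + t) + (s + t) * log 2 := by
  have h := concaveOn_negMulLog.2 (Set.mem_Ici.2 hs) (Set.mem_Ici.2 ht)
    (inv_nonneg.2 zero_le_two) (inv_nonneg.2 zero_le_two) (by norm_num : (2⁻¹ : ℝ) + 2⁻¹ = 1)
  simp only [smul_eq_mul] at h
  rw [← mul_add, ← mul_add, negMulLog_mul] at h
  have h2 : negMulLog (2⁻¹ : ℝ) = 2⁻¹ * log 2 := by simp [negMulLog]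
  rw [h2] at h
  linarith

lemma negMulLog_le_negMulLog_add {u v : ℝ} (hu : 0 ≤ u) (hv : 0 < v) (huv : u + v ≤ 1) :
    negMulLog v ≤ negMulLog (u + v) + u := by
  have h1 : log (u + v) - log v ≤ u / v := by
    rw [← log_div (by positivity) hv.ne']
    have := log_le_sub_one_of_pos (x := (u + v) / v) (by positivity)
    rwa [add_div, div_self hv.ne', add_sub_cancel_right, ← div_self hv.ne', ← add_div] at this
  have h2 : v * (log (u + v) - log v) ≤ u := by
    calc _ ≤ v * (u / v) := by gcongr
      _ = u := mul_div_cancel₀ _ hv.ne'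
  have h3 : u * log (u + v) ≤ 0 :=
    mul_nonpos_of_nonneg_of_nonpos hu (log_nonpos (by positivity) huv)
  simp only [negMulLog]
  linarith

lemma negMulLog_le_binEntropy {x : ℝ} (hx₀ : 0 ≤ x) (hx₁ : x ≤ 1) :
    negMulLog x ≤ binEntropy x := by
  rw [binEntropy_eq_negMulLog_add_negMulLog_one_sub]
  have := negMulLog_nonneg (x := 1 - x) (by linarith) (by linarith)
  linarith

lemma binEntropy_add_sub_le_binEntropy_bernoulliConv {x y : ℝ} (hx₀ : 0 ≤ x) (hx₁ : x ≤ 2⁻¹)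
    (hy₀ : 0 ≤ y) (hy₁ : y ≤ 2⁻¹) :
    binEntropy x + binEntropy y - (x + y) * log 2 - 2 * (x * binEntropy y + y * binEntropy x) ≤
      binEntropy (bernoulliConv x y) := by
  have hxy := mul_nonneg hx₀ hy₀
  have e1 : (1 - bernoulliConv x y) = x * y + (1 - x) * (1 - y) := by rw [bernoulliConv]; ring
  have e2 : bernoulliConv x y = x * (1 - y) + (1 - x) * y := rfl
  have h1 := negMulLog_add_le (s := x * (1 - y)) (t := (1 - x) * y)
    (mul_nonneg hx₀ (by linarith)) (mul_nonneg (by linarith) hy₀)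
  have hlog : (1 / 2 : ℝ) < log 2 := by linarith [log_two_gt_d9]
  have h2 := negMulLog_le_negMulLog_add (u := x * y) (v := (1 - x) * (1 - y)) hxy
    (mul_pos (by linarith) (by linarith)) (by nlinarith)
  rw [← e2] at h1
  rw [← e1] at h2
  have hb : (x * (1 - y) + (1 - x) * y) * log 2 ≤ (x + y) * log 2 := by
    gcongr <;> nlinarith
  have h3 : x * negMulLog y ≤ x * binEntropy y := by
    gcongr; exact negMulLog_le_binEntropy hy₀ (by linarith)
  have h4 : y * negMulLog x ≤ y * binEntropy x := by
    gcongr; exact negMulLog_le_binEntropy hx₀ (by linarith)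
  have h5 : x * y ≤ x * binEntropy y := by
    gcongr
    nlinarith [two_mul_mul_log_two_le_binEntropy hy₀ hy₁]
  have h6 : 0 ≤ y * binEntropy x := mul_nonneg hy₀ (binEntropy_nonneg hx₀ (by linarith))
  simp only [negMulLog_mul] at h1 h2
  have e3 := negMulLog_mul x y
  have hw : bernoulliConv x y * log 2 ≤ (x + y) * log 2 := hb
  simp only [binEntropy_eq_negMulLog_add_negMulLog_one_sub (bernoulliConv x y)]
  have ex := binEntropy_eq_negMulLog_add_negMulLog_one_sub x
  have ey := binEntropy_eq_negMulLog_add_negMulLog_one_sub y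
  have : binEntropy x + binEntropy y =
      (1 - y) * negMulLog x + x * negMulLog (1 - y) + (y * negMulLog (1 - x) + (1 - x) * negMulLog y)
      + (y * negMulLog x + x * negMulLog y)
      + ((1 - y) * negMulLog (1 - x) + (1 - x) * negMulLog (1 - y)) := by
    rw [ex, ey]; ring
  linarith

/-- Lower bound for the entropy of the sum of two Bernoulli variables `X`, `Y` with entropies
`a`, `b` and biases `x`, `y`. It is affine in `(x, a)` and in `(y, b)`. -/
noncomputable def convBound (s : Prop) [Decidable s] (x a y b : ℝ) : ℝ :=
  if s then (1 - 2 * y) * a + 2 * y * log 2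
  else 3 / 4 * (a + b) - 3 / 2 * (x * b + y * a)

lemma convBound_le_binEntropy_of_le_half (s : Prop) [Decidable s] {x y : ℝ} (hx₀ : 0 ≤ x)
    (hx₁ : x ≤ 2⁻¹) (hy₀ : 0 ≤ y) (hy₁ : y ≤ 2⁻¹) :
    convBound s x (binEntropy x) y (binEntropy y) ≤ binEntropy (bernoulliConv x y) := by
  have h1 := le_binEntropy_bernoulliConv_of_le_half hx₀ (by linarith) hy₀ hy₁
  have h2 := le_binEntropy_bernoulliConv_of_le_half hy₀ (by linarith) hx₀ hx₁
  have h3 := binEntropy_add_sub_le_binEntropy_bernoulliConv hx₀ hx₁ hy₀ hy₁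
  have e : bernoulliConv y x = bernoulliConv x y := by simp only [bernoulliConv]; ring
  rw [e] at h2
  rw [convBound]
  split_ifs <;> linarith

lemma convBound_le_binEntropy (s : Prop) [Decidable s] {x y : ℝ} (hx₀ : 0 ≤ x)
    (hx₁ : x ≤ 1) (hy₀ : 0 ≤ y) (hy₁ : y ≤ 1) :
    convBound s (min (1 - x) x) (binEntropy x) (min (1 - y) y) (binEntropy y) ≤
      binEntropy (bernoulliConv x y) := by
  have key : ∀ z : ℝ, 0 ≤ z → z ≤ 1 → 0 ≤ min (1 - z) z ∧ min (1 - z) z ≤ 2⁻¹ ∧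
      (min (1 - z) z = z ∨ min (1 - z) z = 1 - z) := fun z h0 h1 ↦ by
    rcases le_total (1 - z) z with h | h
    · rw [min_eq_left h]; exact ⟨by linarith, by linarith, .inr rfl⟩
    · rw [min_eq_right h]; exact ⟨by linarith, by linarith, .inl rfl⟩
  obtain ⟨hx1, hx2, hx⟩ := key x hx₀ hx₁
  obtain ⟨hy1, hy2, hy⟩ := key y hy₀ hy₁
  have h := convBound_le_binEntropy_of_le_half s hx1 hx2 hy1 hy2
  have ex : binEntropy (min (1 - x) x) = binEntropy x := by rcases hx with h | h <;> simp [h]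
  have ey : binEntropy (min (1 - y) y) = binEntropy y := by rcases hy with h | h <;> simp [h]
  rw [ex, ey] at h
  refine h.trans_eq ?_
  rcases hx with hx | hx <;> rcases hy with hy | hy <;> rw [hx, hy]
  · rw [← binEntropy_one_sub]; congr 1; simp only [bernoulliConv]; ring
  · rw [← binEntropy_one_sub]; congr 1; simp only [bernoulliConv]; ring
  · congr 1; simp only [bernoulliConv]; ring

section Triple

variable {M : ℝ}

lemma prod_add_le_of_even {a b c x y z : ℝ} (hx : 0 ≤ x) (hy : 0 ≤ y) (hz : 0 ≤ z)
    (hxa : x ≤ a) (hyb : y ≤ b) (hzc : z ≤ c) (h : a * b * c ≤ M) (hX : 2 * (x * b * c) ≤ M)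
    (hY : 2 * (a * y * c) ≤ M) (hZ : 2 * (a * b * z) ≤ M) :
    (a + x) * (b + y) * (c + z) ≤ 4 * M := by
  rcases (hx.trans hxa).eq_or_lt with rfl | ha
  · obtain rfl := le_antisymm hxa hx
    simp only [zero_mul, add_zero] at h ⊢; linarith
  rcases (hy.trans hyb).eq_or_lt with rfl | hb
  · obtain rfl := le_antisymm hyb hy
    simp only [zero_mul, mul_zero, add_zero] at h ⊢; linarith
  rcases (hz.trans hzc).eq_or_lt with rfl | hc
  · obtain rfl := le_antisymm hzc hz
    simp only [mul_zero, add_zero] at h ⊢; linarith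
  obtain ⟨t, rfl⟩ : ∃ t, x = a * t := ⟨x / a, by field_simp⟩
  obtain ⟨u, rfl⟩ : ∃ t, y = b * t := ⟨y / b, by field_simp⟩
  obtain ⟨v, rfl⟩ : ∃ t, z = c * t := ⟨z / c, by field_simp⟩
  replace hx : 0 ≤ t := nonneg_of_mul_nonneg_right hx ha
  replace hy : 0 ≤ u := nonneg_of_mul_nonneg_right hy hb
  replace hz : 0 ≤ v := nonneg_of_mul_nonneg_right hz hc
  replace hxa : t ≤ 1 := by nlinarith
  replace hyb : u ≤ 1 := by nlinarith
  replace hzc : v ≤ 1 := by nlinarith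
  set P := a * b * c with hP
  have hP0 : 0 < P := by positivity
  have e : (a + a * t) * (b + b * u) * (c + c * v) = P * ((1 + t) * (1 + u) * (1 + v)) := by
    rw [hP]; ring
  rw [e]
  obtain ⟨w, hw0, hw1, htw, huw, hvw, hwM⟩ : ∃ w, 0 ≤ w ∧ w ≤ 1 ∧ t ≤ w ∧ u ≤ w ∧ v ≤ w ∧
      2 * (P * w) ≤ M := by
    refine ⟨max t (max u v), by positivity, by simp [*], by simp, by simp, by simp, ?_⟩
    rcases max_choice t (max u v) with h | h <;> rw [h]
    · linarith
    rcases max_choice u v with h | h <;> rw [h] <;> linarith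
  have h1 : (1 + t) * (1 + u) * (1 + v) ≤ (1 + w) * (1 + w) * (1 + w) := by gcongr
  have h2 : P * ((1 + t) * (1 + u) * (1 + v)) ≤ P * ((1 + w) * (1 + w) * (1 + w)) := by gcongr
  rcases le_total w 2⁻¹ with hw | hw
  · have h3 : (1 + w) * (1 + w) * (1 + w) ≤ (1 + 2⁻¹) * (1 + 2⁻¹) * (1 + 2⁻¹) := by gcongr
    nlinarith
  · have h3 : (1 + w) * (1 + w) * (1 + w) ≤ 8 * w := by
      nlinarith [mul_nonneg (sub_nonneg.2 hw) (sub_nonneg.2 hw1),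
        mul_nonneg (mul_nonneg (sub_nonneg.2 hw) (sub_nonneg.2 hw1)) hw0]
    nlinarith

lemma prod_add_le_of_odd {a b c x y z : ℝ} (hx : 0 ≤ x) (hy : 0 ≤ y) (hz : 0 ≤ z)
    (hxa : x ≤ a) (hyb : y ≤ b) (hzc : z ≤ c) (h : 2 * (a * b * c) ≤ M) :
    (a + x) * (b + y) * (c + z) ≤ 4 * M := by
  have : (a + x) * (b + y) * (c + z) ≤ (a + a) * (b + b) * (c + c) := by
    have := hx.trans hxa; have := hy.trans hyb; have := hz.trans hzc
    gcongr
  linarith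

/-- If all products `f i * g j * h k` are at most `M` and those with `i + j + k = 1` are at most
`M / 2`, then the sum of all eight products is at most `4 * M`. -/
lemma prod_add_le_of_parity {f g h : ZMod 2 → ℝ} (hf : ∀ i, 0 ≤ f i) (hg : ∀ i, 0 ≤ g i)
    (hh : ∀ i, 0 ≤ h i) (heven : ∀ i j k, f i * g j * h k ≤ M)
    (hodd : ∀ i j k, i + j + k = 1 → 2 * (f i * g j * h k) ≤ M) :
    (f 0 + f 1) * (g 0 + g 1) * (h 0 + h 1) ≤ 4 * M := by
  have sort : ∀ f : ZMod 2 → ℝ, ∃ i, f (i + 1) ≤ f i ∧ f 0 + f 1 = f i + f (i + 1) := fun f ↦ by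
    rcases le_total (f 1) (f 0) with h | h
    · exact ⟨0, by simpa using h, by simp⟩
    · refine ⟨1, ?_, ?_⟩ <;> rw [show (1 + 1 : ZMod 2) = 0 from rfl]
      exacts [h, add_comm _ _]
  obtain ⟨i, hi, ei⟩ := sort f
  obtain ⟨j, hj, ej⟩ := sort g
  obtain ⟨k, hk, ek⟩ := sort h
  rw [ei, ej, ek]
  have hp : i + j + k = 1 ∨ i + j + k = 0 := by
    generalize i + j + k = l
    clear * -
    decide +revert
  rcases hp with hp | hp
  · exact prod_add_le_of_odd (hf _) (hg _) (hh _) hi hj hk (hodd _ _ _ hp)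
  · refine prod_add_le_of_even (hf _) (hg _) (hh _) hi hj hk (heven _ _ _) (hodd _ _ _ ?_)
      (hodd _ _ _ ?_) (hodd _ _ _ ?_)
    · linear_combination hp
    · linear_combination hp
    · linear_combination hp

end Triple

section Fiber

variable {n : ℕ}

/-- The fibre of `A` over the value `c` of the first coordinate. -/
def firstFiber (A : Finset (F2 (n + 1))) (c : ZMod 2) : Finset (F2 n) :=
  Finset.univ.filter fun x ↦ (Fin.cons c x : F2 (n + 1)) ∈ A

lemma mem_firstFiber {A : Finset (F2 (n + 1))} {c : ZMod 2} {x : F2 n} :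
    x ∈ firstFiber A c ↔ (Fin.cons c x : F2 (n + 1)) ∈ A := by
  simp [firstFiber]

lemma card_eq_card_firstFiber_add (A : Finset (F2 (n + 1))) :
    A.card = (firstFiber A 0).card + (firstFiber A 1).card := by
  have h : ∀ c, (firstFiber A c).card = (A.filter fun x ↦ x 0 = c).card := fun c ↦ by
    refine Finset.card_bij (fun x _ ↦ (Fin.cons c x : F2 (n + 1))) ?_ ?_ ?_
    · intro x hx; simpa [mem_firstFiber] using hx
    · intro x _ y _ h; exact Fin.cons_right_injective _ h
    · intro x hx
      obtain ⟨hx, rfl⟩ := Finset.mem_filter.1 hx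
      exact ⟨Fin.tail x, by simpa [mem_firstFiber] using hx, by simp⟩
  rw [h, h, ← Finset.card_filter_add_card_filter_not (s := A) (fun x ↦ x 0 = 0)]
  congr 3
  ext x
  generalize x 0 = c
  decide +revert

lemma firstFiber_add_subset (A B : Finset (F2 (n + 1))) (c d : ZMod 2) :
    firstFiber A c + firstFiber B d ⊆ firstFiber (A + B) (c + d) := by
  intro z hz
  obtain ⟨x, hx, y, hy, rfl⟩ := Finset.mem_add.1 hz
  rw [mem_firstFiber] at hx hy ⊢
  refine Finset.mem_add.2 ⟨_, hx, _, hy, ?_⟩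
  ext i
  refine Fin.cases ?_ (fun j ↦ ?_) i <;> simp

lemma log_card_firstFiber_add_le (A B : Finset (F2 (n + 1))) {c d e : ZMod 2} (h : c + d = e) :
    log (firstFiber A c + firstFiber B d).card ≤ log (firstFiber (A + B) e).card := by
  subst h
  rcases Nat.eq_zero_or_pos (firstFiber A c + firstFiber B d).card with h | h
  · rw [h]; simpa using log_natCast_nonneg _
  · exact log_le_log (by exact_mod_cast h)
      (by exact_mod_cast Finset.card_le_card (firstFiber_add_subset A B c d))

/-- The proportion of elements of `A` whose first coordinate is `c`. -/
noncomputable def firstDensity (A : Finset (F2 (n + 1))) (c : ZMod 2) : ℝ :=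
  (firstFiber A c).card / A.card

lemma firstDensity_nonneg (A : Finset (F2 (n + 1))) (c : ZMod 2) : 0 ≤ firstDensity A c := by
  unfold firstDensity; positivity

lemma firstDensity_zero {A : Finset (F2 (n + 1))} (hA : A.Nonempty) :
    firstDensity A 0 = 1 - firstDensity A 1 := by
  have : (A.card : ℝ) ≠ 0 := by exact_mod_cast hA.card_ne_zero
  rw [firstDensity, firstDensity, card_eq_card_firstFiber_add] at *
  push_cast at *
  field_simp
  ring

lemma firstDensity_le_one {A : Finset (F2 (n + 1))} (hA : A.Nonempty) :
    firstDensity A 1 ≤ 1 := by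
  linarith [firstDensity_zero hA, firstDensity_nonneg A 0]

lemma firstFiber_nonempty_of_firstDensity_pos {A : Finset (F2 (n + 1))} {c : ZMod 2}
    (h : 0 < firstDensity A c) : (firstFiber A c).Nonempty := by
  by_contra hne
  rw [Finset.not_nonempty_iff_eq_empty] at hne
  simp [firstDensity, hne] at h

/-- The entropy of the `i`-th coordinate of a uniform element of `A` conditioned on the previous
coordinates. -/
noncomputable def condEntropy : {n : ℕ} → Finset (F2 n) → Fin n → ℝ
  | 0, _ => fun _ ↦ 0
  | _ + 1, A => Fin.cases (binEntropy (firstDensity A 1)) fun j ↦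
      firstDensity A 0 * condEntropy (firstFiber A 0) j +
        firstDensity A 1 * condEntropy (firstFiber A 1) j

/-- The average, over a uniform element of `A`, of the probability of the less likely value of the
`i`-th coordinate given the previous coordinates. -/
noncomputable def condBias : {n : ℕ} → Finset (F2 n) → Fin n → ℝ
  | 0, _ => fun _ ↦ 0
  | _ + 1, A => Fin.cases (min (1 - firstDensity A 1) (firstDensity A 1)) fun j ↦
      firstDensity A 0 * condBias (firstFiber A 0) j +
        firstDensity A 1 * condBias (firstFiber A 1) j

lemma condEntropy_zero (A : Finset (F2 (n + 1))) :
    condEntropy A 0 = binEntropy (firstDensity A 1) := rfl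

lemma condEntropy_succ (A : Finset (F2 (n + 1))) (j : Fin n) :
    condEntropy A j.succ = firstDensity A 0 * condEntropy (firstFiber A 0) j +
      firstDensity A 1 * condEntropy (firstFiber A 1) j := rfl

lemma condBias_zero (A : Finset (F2 (n + 1))) :
    condBias A 0 = min (1 - firstDensity A 1) (firstDensity A 1) := rfl

lemma condBias_succ (A : Finset (F2 (n + 1))) (j : Fin n) :
    condBias A j.succ = firstDensity A 0 * condBias (firstFiber A 0) j +
      firstDensity A 1 * condBias (firstFiber A 1) j := rfl

lemma condEntropy_nonneg_and_le {A : Finset (F2 n)} (hA : A.Nonempty) (i : Fin n) :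
    0 ≤ condEntropy A i ∧ condEntropy A i ≤ log 2 := by
  induction n with
  | zero => exact i.elim0
  | succ n ih =>
    refine Fin.cases ?_ (fun j ↦ ?_) i
    · rw [condEntropy_zero]
      exact ⟨binEntropy_nonneg (firstDensity_nonneg A 1) (firstDensity_le_one hA),
        binEntropy_le_log_two⟩
    · have key : ∀ c, 0 ≤ firstDensity A c * condEntropy (firstFiber A c) j ∧
          firstDensity A c * condEntropy (firstFiber A c) j ≤ firstDensity A c * log 2 := fun c ↦ by
        rcases (firstDensity_nonneg A c).eq_or_lt with h | h
        · simp [← h]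
        · have := ih (firstFiber_nonempty_of_firstDensity_pos h) j
          exact ⟨mul_nonneg h.le this.1, by gcongr; exact this.2⟩
      rw [condEntropy_succ]
      refine ⟨add_nonneg (key 0).1 (key 1).1, ?_⟩
      have e : log 2 = firstDensity A 0 * log 2 + firstDensity A 1 * log 2 := by
        rw [firstDensity_zero hA]; ring
      linarith [(key 0).2, (key 1).2]

/-- The chain rule for the entropy of a uniform element of `A`. -/
lemma log_card_le_sum_condEntropy {A : Finset (F2 n)} (hA : A.Nonempty) :
    log A.card ≤ ∑ i, condEntropy A i := by
  induction n with
  | zero =>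
    have : A.card ≤ 1 := Finset.card_le_one_of_subsingleton A
    simpa using log_nonpos (by positivity) (by exact_mod_cast this)
  | succ n ih =>
    have key : ∀ c, firstDensity A c * log (firstFiber A c).card ≤
        firstDensity A c * ∑ i, condEntropy (firstFiber A c) i := fun c ↦ by
      rcases (firstDensity_nonneg A c).eq_or_lt with h | h
      · simp [← h]
      · gcongr; exact ih (firstFiber_nonempty_of_firstDensity_pos h)
    have hA0 : (A.card : ℝ) ≠ 0 := by exact_mod_cast hA.card_ne_zero
    have loss : ∀ c, negMulLog (firstDensity A c) =
        firstDensity A c * (log A.card - log (firstFiber A c).card) := fun c ↦ by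
      rcases (firstDensity_nonneg A c).eq_or_lt with h | h
      · simp [← h]
      · have : ((firstFiber A c).card : ℝ) ≠ 0 := by
          exact_mod_cast (firstFiber_nonempty_of_firstDensity_pos h).card_ne_zero
        rw [negMulLog]
        nth_rw 2 [firstDensity]
        rw [log_div this hA0]; ring
    rw [Fin.sum_univ_succ, condEntropy_zero, binEntropy_eq_negMulLog_add_negMulLog_one_sub,
      ← firstDensity_zero hA, loss, loss]
    simp only [condEntropy_succ, Finset.sum_add_distrib, ← Finset.mul_sum]
    have e : log A.card = firstDensity A 0 * log A.card + firstDensity A 1 * log A.card := by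
      rw [firstDensity_zero hA]; ring
    linarith [key 0, key 1]

lemma binEntropy_add_le_log_card_add {A B : Finset (F2 (n + 1))} (hA : A.Nonempty)
    (hB : B.Nonempty) :
    binEntropy (bernoulliConv (firstDensity A 1) (firstDensity B 1)) +
      (firstDensity A 0 * firstDensity B 0 * log (firstFiber A 0 + firstFiber B 0).card +
        firstDensity A 0 * firstDensity B 1 * log (firstFiber A 0 + firstFiber B 1).card +
        firstDensity A 1 * firstDensity B 0 * log (firstFiber A 1 + firstFiber B 0).card +
        firstDensity A 1 * firstDensity B 1 * log (firstFiber A 1 + firstFiber B 1).card) ≤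
      log (A + B).card := by
  have w : ∀ c d, 0 ≤ firstDensity A c * firstDensity B d := fun c d ↦
    mul_nonneg (firstDensity_nonneg A c) (firstDensity_nonneg B d)
  have pos : ∀ c d e, c + d = e → 0 < firstDensity A c * firstDensity B d →
      (0 : ℝ) < (firstFiber (A + B) e).card := by
    rintro c d e rfl h
    have h1 : 0 < firstDensity A c :=
      (firstDensity_nonneg A c).lt_of_ne fun h' ↦ by simp [← h'] at h
    have h2 : 0 < firstDensity B d :=
      (firstDensity_nonneg B d).lt_of_ne fun h' ↦ by simp [← h'] at h
    exact_mod_cast (((firstFiber_nonempty_of_firstDensity_pos h1).add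
      (firstFiber_nonempty_of_firstDensity_pos h2)).mono (firstFiber_add_subset A B c d)).card_pos
  have e1 : bernoulliConv (firstDensity A 1) (firstDensity B 1) =
      firstDensity A 1 * firstDensity B 0 + firstDensity A 0 * firstDensity B 1 := by
    rw [bernoulliConv, firstDensity_zero hA, firstDensity_zero hB]
  have e0 : 1 - bernoulliConv (firstDensity A 1) (firstDensity B 1) =
      firstDensity A 0 * firstDensity B 0 + firstDensity A 1 * firstDensity B 1 := by
    rw [bernoulliConv, firstDensity_zero hA, firstDensity_zero hB]; ring
  have h := binEntropy_add_le_log_add (p := bernoulliConv (firstDensity A 1) (firstDensity B 1))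
    (c := (firstFiber (A + B) 1).card) (d := (firstFiber (A + B) 0).card)
    (by rw [e1]; exact add_nonneg (w _ _) (w _ _))
    (by rw [← sub_nonneg, e0]; exact add_nonneg (w _ _) (w _ _)) (by positivity) (by positivity)
    (fun h ↦ by
      rw [e1] at h
      rcases (w 1 0).eq_or_lt with h' | h'
      · exact pos 0 1 1 rfl (by linarith)
      · exact pos 1 0 1 rfl h')
    (fun h ↦ by
      rw [← sub_pos, e0] at h
      rcases (w 0 0).eq_or_lt with h' | h'
      · exact pos 1 1 0 rfl (by linarith)
      · exact pos 0 0 0 rfl h')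
  rw [e0] at h
  nth_rw 2 [e1] at h
  rw [add_comm ((firstFiber (A + B) 1).card : ℝ), ← Nat.cast_add,
    ← card_eq_card_firstFiber_add] at h
  have m : ∀ c d e, c + d = e → firstDensity A c * firstDensity B d *
      log (firstFiber A c + firstFiber B d).card ≤
      firstDensity A c * firstDensity B d * log (firstFiber (A + B) e).card := fun c d e he ↦
    mul_le_mul_of_nonneg_left (log_card_firstFiber_add_le A B he) (w c d)
  linarith [m 0 0 0 rfl, m 0 1 1 rfl, m 1 0 1 rfl, m 1 1 0 rfl]

/-- Entropic lower bound for the size of a sumset, coordinate by coordinate. -/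
lemma sum_convBound_le_log_card_add (S : Fin n → Prop) [DecidablePred S] {A B : Finset (F2 n)}
    (hA : A.Nonempty) (hB : B.Nonempty) :
    ∑ i, convBound (S i) (condBias A i) (condEntropy A i) (condBias B i) (condEntropy B i) ≤
      log (A + B).card := by
  induction n with
  | zero => simpa using log_natCast_nonneg _
  | succ n ih =>
    refine le_trans ?_ (binEntropy_add_le_log_card_add hA hB)
    have key : ∀ c d, firstDensity A c * firstDensity B d * ∑ i : Fin n, convBound (S i.succ)
        (condBias (firstFiber A c) i) (condEntropy (firstFiber A c) i)
        (condBias (firstFiber B d) i) (condEntropy (firstFiber B d) i) ≤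
        firstDensity A c * firstDensity B d * log (firstFiber A c + firstFiber B d).card := by
      intro c d
      rcases (firstDensity_nonneg A c).eq_or_lt with h | h
      · simp [← h]
      rcases (firstDensity_nonneg B d).eq_or_lt with h' | h'
      · simp [← h']
      gcongr
      exact ih (fun i ↦ S i.succ) (firstFiber_nonempty_of_firstDensity_pos h)
        (firstFiber_nonempty_of_firstDensity_pos h')
    have affine : ∀ i : Fin n, convBound (S i.succ) (condBias A i.succ) (condEntropy A i.succ)
        (condBias B i.succ) (condEntropy B i.succ) =
        ∑ c : ZMod 2, ∑ d : ZMod 2, firstDensity A c * firstDensity B d * convBound (S i.succ)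
          (condBias (firstFiber A c) i) (condEntropy (firstFiber A c) i)
          (condBias (firstFiber B d) i) (condEntropy (firstFiber B d) i) := fun i ↦ by
      have univ2 : ∀ f : ZMod 2 → ℝ, ∑ c, f c = f 0 + f 1 := Fin.sum_univ_two
      simp only [univ2, convBound, condBias_succ, condEntropy_succ, firstDensity_zero hA,
        firstDensity_zero hB]
      split_ifs <;> ring
    have univ2 : ∀ f : ZMod 2 → ℝ, ∑ c, f c = f 0 + f 1 := Fin.sum_univ_two
    rw [Fin.sum_univ_succ, condBias_zero, condBias_zero, condEntropy_zero, condEntropy_zero]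
    simp only [affine]
    simp only [univ2, Finset.sum_add_distrib, ← Finset.mul_sum]
    have h0 := convBound_le_binEntropy (S 0) (firstDensity_nonneg A 1) (firstDensity_le_one hA)
      (firstDensity_nonneg B 1) (firstDensity_le_one hB)
    linarith [key 0 0, key 0 1, key 1 0, key 1 1]

lemma hammingNorm_cons (c : ZMod 2) (x : F2 n) :
    hammingNorm (Fin.cons c x : F2 (n + 1)) = (if c = 0 then 0 else 1) + hammingNorm x := by
  simp only [hammingNorm, Finset.card_filter, Fin.sum_univ_succ, Fin.cons_zero, Fin.cons_succ]
  simp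

/-- The part of the entropy of a uniform element of `A` carried by the coordinates in `S`. -/
noncomputable def partialEntropy (S : Fin n → Prop) [DecidablePred S] (A : Finset (F2 n)) : ℝ :=
  ∑ i, if S i then condEntropy A i else 0

lemma partialEntropy_succ (S : Fin (n + 1) → Prop) [DecidablePred S] (A : Finset (F2 (n + 1))) :
    partialEntropy S A = (if S 0 then binEntropy (firstDensity A 1) else 0) +
      (firstDensity A 0 * partialEntropy (fun i ↦ S i.succ) (firstFiber A 0) +
        firstDensity A 1 * partialEntropy (fun i ↦ S i.succ) (firstFiber A 1)) := by
  simp only [partialEntropy, Fin.sum_univ_succ, condEntropy_zero, condEntropy_succ,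
    Finset.mul_sum, ← Finset.sum_add_distrib]
  congr 1
  refine Finset.sum_congr rfl fun i _ ↦ ?_
  split_ifs <;> simp

lemma exists_partialEntropy_le (S : Fin (n + 1) → Prop) [DecidablePred S] (hS : ¬ S 0)
    {A : Finset (F2 (n + 1))} (hA : A.Nonempty) :
    ∃ c, (firstFiber A c).Nonempty ∧
      partialEntropy S A ≤ partialEntropy (fun i ↦ S i.succ) (firstFiber A c) := by
  by_contra! h
  have key : ∀ c, firstDensity A c * partialEntropy (fun i ↦ S i.succ) (firstFiber A c) ≤
      firstDensity A c * partialEntropy S A ∧ (0 < firstDensity A c →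
      firstDensity A c * partialEntropy (fun i ↦ S i.succ) (firstFiber A c) <
      firstDensity A c * partialEntropy S A) := fun c ↦ by
    rcases (firstDensity_nonneg A c).eq_or_lt with hpos | hpos
    · simp [← hpos]
    · have := mul_lt_mul_of_pos_left (h c (firstFiber_nonempty_of_firstDensity_pos hpos)) hpos
      exact ⟨this.le, fun _ ↦ this⟩
  have e := partialEntropy_succ S A
  rw [if_neg hS] at e
  have e2 : partialEntropy S A = firstDensity A 0 * partialEntropy S A +
      firstDensity A 1 * partialEntropy S A := by rw [firstDensity_zero hA]; ring
  rcases (firstDensity_nonneg A 1).eq_or_lt with hpos | hpos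
  · have := (key 0).2 (by rw [firstDensity_zero hA]; linarith)
    linarith [(key 1).1]
  · linarith [(key 0).1, (key 1).2 hpos]

/-- The exponential of `partialEntropy` of a fibre, with the convention that it vanishes on empty
fibres. -/
noncomputable def fiberWeight (S : Fin n → Prop) [DecidablePred S] (A : Finset (F2 (n + 1)))
    (c : ZMod 2) : ℝ :=
  if (firstFiber A c).Nonempty then exp (partialEntropy S (firstFiber A c)) else 0

lemma fiberWeight_nonneg (S : Fin n → Prop) [DecidablePred S] (A : Finset (F2 (n + 1)))
    (c : ZMod 2) : 0 ≤ fiberWeight S A c := by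
  unfold fiberWeight; split_ifs <;> positivity

lemma exp_partialEntropy_le (S : Fin (n + 1) → Prop) [DecidablePred S] (hS : S 0)
    {A : Finset (F2 (n + 1))} (hA : A.Nonempty) :
    exp (partialEntropy S A) ≤
      fiberWeight (fun i ↦ S i.succ) A 0 + fiberWeight (fun i ↦ S i.succ) A 1 := by
  have pos : ∀ c, 0 < firstDensity A c → 0 < fiberWeight (fun i ↦ S i.succ) A c := fun c h ↦ by
    rw [fiberWeight, if_pos (firstFiber_nonempty_of_firstDensity_pos h)]; positivity
  have eq : ∀ c, firstDensity A c * log (fiberWeight (fun i ↦ S i.succ) A c) =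
      firstDensity A c * partialEntropy (fun i ↦ S i.succ) (firstFiber A c) := fun c ↦ by
    rcases (firstDensity_nonneg A c).eq_or_lt with h | h
    · simp [← h]
    · rw [fiberWeight, if_pos (firstFiber_nonempty_of_firstDensity_pos h), log_exp]
  have w := fiberWeight_nonneg (fun i ↦ S i.succ) A
  have h := binEntropy_add_le_log_add (firstDensity_nonneg A 1) (firstDensity_le_one hA) (w 1)
    (w 0) (pos 1) fun h ↦ pos 0 (by rw [firstDensity_zero hA]; linarith)
  rw [← firstDensity_zero hA, eq, eq] at h
  rw [← le_log_iff_exp_le, partialEntropy_succ, if_pos hS]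
  · rw [add_comm (fiberWeight _ A 0)]
    linarith
  · rcases (firstDensity_nonneg A 1).eq_or_lt with hlt | hlt
    · have := pos 0 (by rw [firstDensity_zero hA]; linarith)
      linarith [w 1]
    · linarith [w 0, pos 1 hlt]

/-- A triple sumset contains a vector of large Hamming norm. -/
lemma partialEntropy_add_le_of_hammingNorm_le (S : Fin n → Prop) [DecidablePred S]
    {A B D : Finset (F2 n)} (hA : A.Nonempty) (hB : B.Nonempty) (hD : D.Nonempty) {r : ℝ}
    (hr : ∀ a ∈ A, ∀ b ∈ B, ∀ d ∈ D, (hammingNorm (a + b + d) : ℝ) ≤ r) :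
    partialEntropy S A + partialEntropy S B + partialEntropy S D ≤
      r * log 2 + ∑ i, if S i then 2 * log 2 else 0 := by
  induction n generalizing r with
  | zero =>
    obtain ⟨a, ha⟩ := hA
    obtain ⟨b, hb⟩ := hB
    obtain ⟨d, hd⟩ := hD
    have : 0 ≤ r := le_trans (by positivity) (hr a ha b hb d hd)
    simpa [partialEntropy] using mul_nonneg this (log_nonneg one_le_two)
  | succ n ih =>
    set S' : Fin n → Prop := fun i ↦ S i.succ
    have hcons : ∀ i j k, ∀ a ∈ firstFiber A i, ∀ b ∈ firstFiber B j, ∀ d ∈ firstFiber D k,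
        (if i + j + k = 0 then 0 else 1) + (hammingNorm (a + b + d) : ℝ) ≤ r := by
      intro i j k a ha b hb d hd
      have h := hr _ (mem_firstFiber.1 ha) _ (mem_firstFiber.1 hb) _ (mem_firstFiber.1 hd)
      have e : (Fin.cons i a + Fin.cons j b + Fin.cons k d : F2 (n + 1)) =
          Fin.cons (i + j + k) (a + b + d) := by
        ext l
        refine Fin.cases ?_ (fun l ↦ ?_) l <;> simp
      rw [e, hammingNorm_cons] at h
      push_cast at h
      exact h
    have heven : ∀ i j k, ∀ a ∈ firstFiber A i, ∀ b ∈ firstFiber B j, ∀ d ∈ firstFiber D k,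
        (hammingNorm (a + b + d) : ℝ) ≤ r := fun i j k a ha b hb d hd ↦ by
      have := hcons i j k a ha b hb d hd
      split_ifs at this <;> linarith
    rw [Fin.sum_univ_succ]
    by_cases h0 : S 0
    · set T := ∑ i, if S' i then 2 * log 2 else 0
      have prod : ∀ i j k, ∀ r', (∀ a ∈ firstFiber A i, ∀ b ∈ firstFiber B j,
          ∀ d ∈ firstFiber D k, (hammingNorm (a + b + d) : ℝ) ≤ r') →
          fiberWeight S' A i * fiberWeight S' B j * fiberWeight S' D k ≤
            exp (r' * log 2 + T) := by
        intro i j k r' h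
        unfold fiberWeight
        split_ifs with h1 h2 h3
        · rw [← exp_add, ← exp_add, exp_le_exp]
          exact ih S' h1 h2 h3 h
        all_goals simp; try positivity
      have main := prod_add_le_of_parity (M := exp (r * log 2 + T)) (fiberWeight_nonneg S' A)
        (fiberWeight_nonneg S' B) (fiberWeight_nonneg S' D)
        (fun i j k ↦ prod i j k r (heven i j k))
        (fun i j k hijk ↦ by
          have := prod i j k (r - 1) fun a ha b hb d hd ↦ by
            have := hcons i j k a ha b hb d hd
            rw [if_neg (by rw [hijk]; decide)] at this
            linarith
          have e : exp (r * log 2 + T) = 2 * exp ((r - 1) * log 2 + T) := by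
            nth_rw 2 [← exp_log (two_pos : (0 : ℝ) < 2)]
            rw [← exp_add]; congr 1; ring
          linarith)
      have hle : exp (partialEntropy S A) * exp (partialEntropy S B) * exp (partialEntropy S D) ≤
          4 * exp (r * log 2 + T) := by
        refine le_trans ?_ main
        gcongr
        · have := fiberWeight_nonneg S'
          exact mul_nonneg (add_nonneg (this _ _) (this _ _)) (add_nonneg (this _ _) (this _ _))
        · exact add_nonneg (fiberWeight_nonneg S' _ _) (fiberWeight_nonneg S' _ _)
        · exact exp_partialEntropy_le S h0 hA
        · exact exp_partialEntropy_le S h0 hB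
        · exact exp_partialEntropy_le S h0 hD
      have e4 : (4 : ℝ) = exp (2 * log 2) := by
        rw [mul_comm, exp_mul, exp_log two_pos]; norm_num
      rw [e4, ← exp_add, ← exp_add, ← exp_add, exp_le_exp] at hle
      rw [if_pos h0]
      linarith
    · obtain ⟨i, hi, hAi⟩ := exists_partialEntropy_le S h0 hA
      obtain ⟨j, hj, hBj⟩ := exists_partialEntropy_le S h0 hB
      obtain ⟨k, hk, hDk⟩ := exists_partialEntropy_le S h0 hD
      have := ih S' hi hj hk (heven i j k)
      rw [if_neg h0]
      linarith

/-- The escape inequality in natural logarithms, with constant `8`. -/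
lemma log_card_le_of_add_add_subset_hamBall {A : Finset (F2 n)} (hA : A.Nonempty) {K : ℝ}
    (hK : 1 ≤ K) (hAK : ((A + A).card : ℝ) ≤ K * A.card) {r : ℕ} (hr : A + A + A ⊆ hamBall n r) :
    log A.card ≤ r * log 2 + 8 * log K := by
  classical
  set S : Fin n → Prop := fun i ↦ 1 / 8 ≤ condBias A i
  have h1 := sum_convBound_le_log_card_add S hA hA
  have h2 := partialEntropy_add_le_of_hammingNorm_le S hA hA hA (r := r)
    fun a ha b hb d hd ↦ by
      have := hr (Finset.add_mem_add (Finset.add_mem_add ha hb) hd)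
      exact_mod_cast (Finset.mem_filter.1 this).2
  have h3 := log_card_le_sum_condEntropy hA
  have hA0 : (0 : ℝ) < A.card := by exact_mod_cast hA.card_pos
  have h4 : log (A + A).card ≤ log K + log A.card := by
    rw [← log_mul (by positivity) hA0.ne']
    exact log_le_log (by exact_mod_cast (hA.add hA).card_pos) hAK
  have h5 : ∑ i, (9 * condEntropy A i + 2 * (if S i then log 2 else 0)
      - 3 * (if S i then condEntropy A i else 0)) ≤
      ∑ i, 8 * convBound (S i) (condBias A i) (condEntropy A i) (condBias A i)
        (condEntropy A i) := by
    refine Finset.sum_le_sum fun i _ ↦ ?_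
    obtain ⟨hH0, hH1⟩ := condEntropy_nonneg_and_le hA i
    rw [convBound]
    split_ifs with h
    · have h' : 1 / 8 ≤ condBias A i := h
      nlinarith
    · have h' : condBias A i < 1 / 8 := not_le.1 h
      nlinarith
  simp only [Finset.sum_add_distrib, Finset.sum_sub_distrib, ← Finset.mul_sum] at h5
  have e : ∑ i, (if S i then 2 * log 2 else 0) = 2 * ∑ i, if S i then log 2 else 0 := by
    rw [Finset.mul_sum]; exact Finset.sum_congr rfl fun i _ ↦ by split_ifs <;> simp
  rw [e] at h2
  rw [partialEntropy] at h2
  linarith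

end Fiber

end

/-- Small doubling implies escape from Hamming balls (Proposition 4.2):
if `|A+A| ≤ K|A|` and `A + A + A ⊆ H_r(n)` then
`r ≥ log₂|A| - 42 log₂ K - O(1)`. -/
theorem escape_from_hamming_ball :
    ∃ C : ℝ, 0 ≤ C ∧
      ∀ (n : ℕ) (A : Finset (F2 n)), A.Nonempty →
        ∀ K : ℝ, 1 ≤ K → ((A + A).card : ℝ) ≤ K * A.card →
        ∀ r : ℕ, r ≤ n → A + A + A ⊆ hamBall n r →
        Real.logb 2 A.card - 42 * Real.logb 2 K - C ≤ (r : ℝ) := by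
  refine ⟨0, le_rfl, fun n A hA K hK hAK r _ hr ↦ ?_⟩
  have h := log_card_le_of_add_add_subset_hamBall hA hK hAK hr
  have hK0 : 0 ≤ Real.log K := Real.log_nonneg hK
  have h2 : 0 < Real.log 2 := Real.log_pos one_lt_two
  have h3 : (Real.log A.card - 42 * Real.log K) / Real.log 2 ≤ r := by
    rw [div_le_iff₀ h2]; linarith
  rw [Real.logb, Real.logb]
  convert h3 using 1
  ring
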